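/- arXiv:2511.17157 — 2 statements merged into one kernel-verified Lean document; each statement's English description precedes it below -/
import Mathlib

section
/- (Convergence rate of GLALM.) Let X ⊆ ℝⁿ be closed convex, f : ℝⁿ → ℝ convex differentiable with f(x') ≤ f(x) + ⟨∇f(x), x' − x⟩ + (L/2)‖x' − x‖² for all x, x' (L ≥ 0), g : ℝⁿ → ℝ convex, F = f + g, A ∈ ℝ^{l×n}, b ∈ ℝˡ. Let (x*, z*) be a KKT point: x* ∈ X, A x* = b, and F(x) − F(x*) ≥ ⟨z*, A x − b⟩ for all x ∈ X. Run GLALM with parameters θ_k = 2/(k+1), γ_k = kγ, κ_k = κγk/2, P^k = (η/k)I, where γ > 0, η > 0, α := 2L/η ∈ (0, 1), κ ∈ (1, 2), initialized with x¹ = x̂¹ = x_ag¹ ∈ X and z¹ = ẑ¹ = 0. Then for every k ≥ 1: |F(x_ag^{k+1}) − F(x*)| ≤ (1/(k(k+1)))·( (η/(2 − α))·‖x¹ − x*‖² + max{(1 + ‖z*‖)², 4‖z*‖²}/(γκ) ), and ‖A x_ag^{k+1} − b‖ ≤ (1/(k(k+1)))·( (η/(2 − α))·‖x¹ − x*‖²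 + max{(1 + ‖z*‖)², 4‖z*‖²}/(γκ) ). -/
open scoped RealInnerProductSpace

section

variable {E F : Type*} [NormedAddCommGroup E] [InnerProductSpace ℝ E]
  [NormedAddCommGroup F] [InnerProductSpace ℝ F]

/-- The gradient of a convex function gives an affine minorant. -/
theorem ConvexOn.add_inner_le_of_hasGradientAt [CompleteSpace E] {f : E → ℝ} {v x : E}
    (hf : ConvexOn ℝ Set.univ f) (hv : HasGradientAt f v x) (y : E) :
    f x + ⟪v, y - x⟫ ≤ f y := by
  have hconv : ConvexOn ℝ Set.univ fun t : ℝ => f (AffineMap.lineMap x y t) := by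
    simpa [Function.comp_def] using hf.comp_affineMap (AffineMap.lineMap x y)
  have hd : HasDerivAt (fun t : ℝ => f (AffineMap.lineMap x y t)) ⟪v, y - x⟫ 0 := by
    have h := hv.hasFDerivAt
    rw [← AffineMap.lineMap_apply_zero (k := ℝ) x y] at h
    simpa [Function.comp_def] using h.comp_hasDerivAt (0 : ℝ) AffineMap.hasDerivAt_lineMap
  have h := hconv.le_slope_of_hasDerivAt (Set.mem_univ 0) (Set.mem_univ 1) one_pos hd
  simp only [slope_def_field, AffineMap.lineMap_apply_one, AffineMap.lineMap_apply_zero,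
    sub_zero, div_one] at h
  linarith

/-- A quadratic without constant term that is nonnegative on `(0, 1]` has nonnegative slope
at `0`. -/
theorem nonneg_of_forall_mul_add_sq_mul_nonneg {a c : ℝ}
    (h : ∀ t : ℝ, 0 < t → t ≤ 1 → 0 ≤ t * a + t ^ 2 * c) : 0 ≤ a := by
  by_contra! ha
  have hc : 0 < |c| + 1 := by positivity
  have hpos : 0 < min 1 (-a / (2 * (|c| + 1))) :=
    lt_min one_pos (div_pos (by linarith) (by positivity))
  set t := min 1 (-a / (2 * (|c| + 1)))
  have ht : t * (2 * (|c| + 1)) ≤ -a := by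
    rw [← le_div_iff₀ (by positivity)]
    exact min_le_right _ _
  have h1 : 0 ≤ t * (a + t * c) := by
    linarith [h t hpos (min_le_left _ _), show t * (a + t * c) = t * a + t ^ 2 * c by ring]
  have h2 : 0 ≤ a + t * c := nonneg_of_mul_nonneg_right h1 hpos
  nlinarith [mul_le_mul_of_nonneg_left (le_abs_self c) hpos.le]

theorem norm_add_smul_sq (u v : E) (t : ℝ) :
    ‖u + t • v‖ ^ 2 = ‖u‖ ^ 2 + 2 * t * ⟪u, v⟫ + t ^ 2 * ‖v‖ ^ 2 := by
  rw [norm_add_sq_real, real_inner_smul_right, norm_smul, mul_pow, Real.norm_eq_abs, sq_abs]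
  ring

/-- Variational inequality for a minimizer over a convex set of the sum of a linear form, a convex
function and two quadratic penalties. -/
theorem variational_inequality_of_forall_le {X : Set E} (hX : Convex ℝ X) {g : E → ℝ}
    (hg : ConvexOn ℝ Set.univ g) (T : E →ₗ[ℝ] F) (b : F) (c w : E) (σ τ : ℝ) {p y : E}
    (hp : p ∈ X) (hy : y ∈ X)
    (hmin : ∀ y ∈ X, ⟪c, p⟫ + g p + σ / 2 * ‖T p - b‖ ^ 2 + τ / 2 * ‖p - w‖ ^ 2
      ≤ ⟪c, y⟫ + g y + σ / 2 * ‖T y - b‖ ^ 2 + τ / 2 * ‖y - w‖ ^ 2) :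
    0 ≤ ⟪c, y - p⟫ + (g y - g p) + σ * ⟪T p - b, T (y - p)⟫ + τ * ⟪p - w, y - p⟫ := by
  refine nonneg_of_forall_mul_add_sq_mul_nonneg
    (c := σ / 2 * ‖T (y - p)‖ ^ 2 + τ / 2 * ‖y - p‖ ^ 2) fun t ht ht1 => ?_
  have hcomb : (1 - t) • p + t • y = p + t • (y - p) := by module
  have h := hmin _ (hX hp hy (sub_nonneg.2 ht1) ht.le (by ring))
  have hgt := hg.2 (Set.mem_univ p) (Set.mem_univ y) (sub_nonneg.2 ht1) ht.le (by ring)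
  rw [hcomb] at h hgt
  rw [map_add, map_smul, inner_add_right, real_inner_smul_right,
    show T p + t • T (y - p) - b = T p - b + t • T (y - p) by abel,
    show p + t • (y - p) - w = p - w + t • (y - p) by abel,
    norm_add_smul_sq, norm_add_smul_sq] at h
  simp only [smul_eq_mul] at hgt
  linarith

/-- Descent estimate for an averaged step on a composite convex function. -/
theorem composite_averaged_step_le [CompleteSpace E] {f g : E → ℝ} {f' : E → E} {L θ : ℝ}
    (hdiff : ∀ x, HasGradientAt f (f' x) x) (hf : ConvexOn ℝ Set.univ f)
    (hg : ConvexOn ℝ Set.univ g)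
    (hsmooth : ∀ x x', f x' ≤ f x + ⟪f' x, x' - x⟫ + L / 2 * ‖x' - x‖ ^ 2)
    (hθ : 0 ≤ θ) (hθ1 : θ ≤ 1) (q w p y : E) {m q' : E}
    (hm : m = (1 - θ) • q + θ • w) (hq' : q' = (1 - θ) • q + θ • p) :
    f q' + g q' ≤ (1 - θ) * (f q + g q)
      + θ * (f y + ⟪f' m, p - y⟫ + g p) + L / 2 * θ ^ 2 * ‖p - w‖ ^ 2 := by
  have hgq : g q' ≤ (1 - θ) * g q + θ * g p := by
    simpa only [hq', smul_eq_mul] using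
      hg.2 (Set.mem_univ q) (Set.mem_univ p) (sub_nonneg.2 hθ1) hθ (by ring)
  have hs := hsmooth m q'
  have hq := mul_le_mul_of_nonneg_left
    (hf.add_inner_le_of_hasGradientAt (hdiff m) q) (sub_nonneg.2 hθ1)
  have hy := mul_le_mul_of_nonneg_left (hf.add_inner_le_of_hasGradientAt (hdiff m) y) hθ
  have hdir : q' - m = θ • (p - w) := by rw [hm, hq']; module
  have hnorm : ‖q' - m‖ ^ 2 = θ ^ 2 * ‖p - w‖ ^ 2 := by
    rw [hdir, norm_smul, mul_pow, Real.norm_eq_abs, sq_abs]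
  have hinner : ⟪f' m, q' - m⟫
      = (1 - θ) * ⟪f' m, q - m⟫ + θ * (⟪f' m, y - m⟫ + ⟪f' m, p - y⟫) := by
    rw [← inner_add_right, ← real_inner_smul_right, ← real_inner_smul_right, ← inner_add_right]
    congr 1
    rw [hq']
    module
  rw [hnorm, hinner] at hs
  linarith

/-- A bound on the Lagrangian gap for all multipliers `z` controls both the objective residual
and the feasibility residual. -/
theorem abs_le_and_norm_le_of_forall_sub_inner_le {D s P Q : ℝ} {u zstar : F} (hs : 0 ≤ s)
    (hQ : 0 ≤ Q) (hKKT : ⟪zstar, u⟫ ≤ D)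
    (h : ∀ z : F, D - ⟪z, u⟫ ≤ s * (P + ‖z‖ ^ 2 / Q)) :
    |D| ≤ s * (P + max ((1 + ‖zstar‖) ^ 2) (4 * ‖zstar‖ ^ 2) / Q) ∧
      ‖u‖ ≤ s * (P + max ((1 + ‖zstar‖) ^ 2) (4 * ‖zstar‖ ^ 2) / Q) := by
  have key : ∀ z : F, ‖z‖ ^ 2 ≤ max ((1 + ‖zstar‖) ^ 2) (4 * ‖zstar‖ ^ 2) →
      D - ⟪z, u⟫ ≤ s * (P + max ((1 + ‖zstar‖) ^ 2) (4 * ‖zstar‖ ^ 2) / Q) := fun z hz =>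
    (h z).trans (by gcongr)
  have h0 := key 0 (le_max_of_le_left (by rw [norm_zero, zero_pow two_ne_zero]; positivity))
  have h2 := key ((2 : ℝ) • zstar) (le_max_of_le_right (by
    rw [norm_smul, mul_pow]; norm_num))
  have hu := key (zstar - (‖u‖⁻¹) • u) (le_max_of_le_left (by
    gcongr
    refine (norm_sub_le _ _).trans ?_
    rw [norm_smul, norm_inv, norm_norm, add_comm]
    gcongr
    exact inv_mul_le_one))
  rw [inner_zero_left] at h0
  rw [real_inner_smul_left] at h2
  rw [inner_sub_left, real_inner_smul_left, real_inner_self_eq_norm_sq] at hu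
  have hu' : ‖u‖⁻¹ * ‖u‖ ^ 2 = ‖u‖ := by
    rcases eq_or_ne ‖u‖ 0 with h0 | h0
    · simp [h0]
    · field_simp
  exact ⟨abs_le.2 ⟨by linarith, by linarith⟩, by linarith⟩

end

theorem Matrix.inner_toEuclideanLin_transpose {m n : Type*} [Fintype m] [Fintype n]
    [DecidableEq m] [DecidableEq n] (A : Matrix m n ℝ) (z : EuclideanSpace ℝ m)
    (x : EuclideanSpace ℝ n) :
    ⟪Matrix.toEuclideanLin A.transpose z, x⟫ = ⟪z, Matrix.toEuclideanLin A x⟫ := by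
  rw [← Matrix.conjTranspose_eq_transpose_of_trivial,
    Matrix.toEuclideanLin_conjTranspose_eq_adjoint, LinearMap.adjoint_inner_left]

theorem glalm_convergence_rate {n l : ℕ}
    (X : Set (EuclideanSpace ℝ (Fin n))) (hXcl : IsClosed X) (hXcv : Convex ℝ X)
    (f g : EuclideanSpace ℝ (Fin n) → ℝ)
    (f' : EuclideanSpace ℝ (Fin n) → EuclideanSpace ℝ (Fin n))
    (L : ℝ) (hL : 0 ≤ L)
    (hdiff : ∀ x, HasGradientAt f (f' x) x)
    (hfconv : ConvexOn ℝ Set.univ f)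
    (hgconv : ConvexOn ℝ Set.univ g)
    (hsmooth : ∀ x x', f x' ≤ f x + ⟪f' x, x' - x⟫ + L / 2 * ‖x' - x‖ ^ 2)
    (A : Matrix (Fin l) (Fin n) ℝ) (b : EuclideanSpace ℝ (Fin l))
    (xstar : EuclideanSpace ℝ (Fin n)) (zstar : EuclideanSpace ℝ (Fin l))
    (hstarX : xstar ∈ X)
    (hstarfeas : Matrix.toEuclideanLin A xstar = b)
    (hKKT : ∀ x ∈ X, ⟪zstar, Matrix.toEuclideanLin A x - b⟫
      ≤ (f x + g x) - (f xstar + g xstar))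
    (γ η κ : ℝ) (hγ : 0 < γ) (hη : 0 < η)
    (hα : 2 * L / η ∈ Set.Ioo (0 : ℝ) 1) (hκ : κ ∈ Set.Ioo (1 : ℝ) 2)
    (x xhat xag xmd : ℕ → EuclideanSpace ℝ (Fin n))
    (z zhat : ℕ → EuclideanSpace ℝ (Fin l))
    (hinitX : x 1 ∈ X) (hinit1 : x 1 = xhat 1) (hinit2 : x 1 = xag 1)
    (hinitz : z 1 = 0) (hinitzhat : zhat 1 = 0)
    (hmd : ∀ k : ℕ, 1 ≤ k →
      xmd k = (1 - 2 / ((k : ℝ) + 1)) • xag k + (2 / ((k : ℝ) + 1)) • xhat k)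
    (hxX : ∀ k : ℕ, 1 ≤ k → x (k + 1) ∈ X)
    (hmin : ∀ k : ℕ, 1 ≤ k → ∀ y ∈ X,
      ⟪f' (xmd k) - Matrix.toEuclideanLin A.transpose (zhat k), x (k + 1)⟫ + g (x (k + 1))
          + (κ * γ * (k : ℝ) / 2) / 2 * ‖Matrix.toEuclideanLin A (x (k + 1)) - b‖ ^ 2
          + η / (2 * (k : ℝ)) * ‖x (k + 1) - xhat k‖ ^ 2
        ≤ ⟪f' (xmd k) - Matrix.toEuclideanLin A.transpose (zhat k), y⟫ + g y
          + (κ * γ * (k : ℝ) / 2) / 2 * ‖Matrix.toEuclideanLin A y - b‖ ^ 2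
          + η / (2 * (k : ℝ)) * ‖y - xhat k‖ ^ 2)
    (hhat : ∀ k : ℕ, 1 ≤ k →
      xhat (k + 1) = (2 * L / η - 1) • xhat k + (2 - 2 * L / η) • x (k + 1))
    (hag : ∀ k : ℕ, 1 ≤ k →
      xag (k + 1) = (1 - 2 / ((k : ℝ) + 1)) • xag k + (2 / ((k : ℝ) + 1)) • x (k + 1))
    (hz : ∀ k : ℕ, 1 ≤ k →
      z (k + 1) = zhat k - ((k : ℝ) * γ) • (Matrix.toEuclideanLin A (x (k + 1)) - b))
    (hzhat : ∀ k : ℕ, 1 ≤ k →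
      zhat (k + 1) = (1 - κ) • zhat k + κ • z (k + 1)) :
    ∀ k : ℕ, 1 ≤ k →
      |(f (xag (k + 1)) + g (xag (k + 1))) - (f xstar + g xstar)|
          ≤ 1 / ((k : ℝ) * ((k : ℝ) + 1))
            * (η / (2 - 2 * L / η) * ‖x 1 - xstar‖ ^ 2
              + max ((1 + ‖zstar‖) ^ 2) (4 * ‖zstar‖ ^ 2) / (γ * κ)) ∧
        ‖Matrix.toEuclideanLin A (xag (k + 1)) - b‖
          ≤ 1 / ((k : ℝ) * ((k : ℝ) + 1))
            * (η / (2 - 2 * L / η) * ‖x 1 - xstar‖ ^ 2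
              + max ((1 + ‖zstar‖) ^ 2) (4 * ‖zstar‖ ^ 2) / (γ * κ)) := by
  obtain ⟨hα0, hα1⟩ := hα
  have hκ0 : 0 < κ := one_pos.trans hκ.1
  set T := Matrix.toEuclideanLin A with hT
  set α := 2 * L / η with hαdef
  have hLα : 2 * L = α * η := by rw [hαdef]; field_simp
  have hβ : 0 < 2 - α := by linarith
  have hθ : ∀ k : ℕ, 1 ≤ k → 2 / ((k : ℝ) + 1) ≤ 1 := fun k hk => by
    have : (1 : ℝ) ≤ k := by exact_mod_cast hk
    rw [div_le_one (by positivity)]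
    linarith
  have hagX : ∀ k : ℕ, 1 ≤ k → xag k ∈ X := by
    intro k hk
    induction k, hk using Nat.le_induction with
    | base => exact hinit2 ▸ hinitX
    | succ k hk ih =>
      rw [hag k hk]
      exact hXcv ih (hxX k hk) (sub_nonneg.2 (hθ k hk)) (by positivity) (by ring)
  -- `Φ z q` is the Lagrangian gap at the primal point `q` for the multiplier `z`.
  let Φ := fun (z' : EuclideanSpace ℝ (Fin l)) (q : EuclideanSpace ℝ (Fin n)) =>
    f q + g q - (f xstar + g xstar) - ⟪z', T q - b⟫
  have hstep : ∀ z' : EuclideanSpace ℝ (Fin l), ∀ k : ℕ, 1 ≤ k →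
      (k : ℝ) * (k + 1) * Φ z' (xag (k + 1)) + η / (2 - α) * ‖xhat (k + 1) - xstar‖ ^ 2
          + ‖zhat (k + 1) - z'‖ ^ 2 / (γ * κ)
        ≤ ((k : ℝ) - 1) * k * Φ z' (xag k) + η / (2 - α) * ‖xhat k - xstar‖ ^ 2
          + ‖zhat k - z'‖ ^ 2 / (γ * κ) := by
    intro z' k hk
    have hk1 : (1 : ℝ) ≤ k := by exact_mod_cast hk
    have hk0 : (0 : ℝ) < k := by linarith
    set K : ℝ := (k : ℝ)
    set p := x (k + 1)
    set w := xhat k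
    set ζ := zhat k
    set r := T p - b with hr
    have hvi := variational_inequality_of_forall_le hXcv hgconv T b
      (f' (xmd k) - Matrix.toEuclideanLin A.transpose ζ) w (κ * γ * K / 2) (η / K)
      (hxX k hk) hstarX (fun y hy => by
        have h := hmin k hk y hy
        rwa [show η / (2 * K) = η / K / 2 by field_simp] at h)
    have hTr : T (xstar - p) = -r := by rw [map_sub, hstarfeas, hr, neg_sub]
    rw [inner_sub_left, Matrix.inner_toEuclideanLin_transpose, ← hT, hTr, inner_neg_right,
      inner_neg_right, ← hr, real_inner_self_eq_norm_sq, ← neg_sub p xstar, inner_neg_right,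
      inner_neg_right] at hvi
    have hdesc := composite_averaged_step_le hdiff hfconv hgconv hsmooth
      (by positivity) (hθ k hk) (xag k) w p xstar (hmd k hk) (hag k hk)
    have hres : ⟪z', T (xag (k + 1)) - b⟫
        = (1 - 2 / (K + 1)) * ⟪z', T (xag k) - b⟫ + 2 / (K + 1) * ⟪z', r⟫ := by
      rw [← real_inner_smul_right, ← real_inner_smul_right, ← inner_add_right, hag k hk,
        map_add, map_smul, map_smul, hr]
      congr 1
      module
    have hdual : ‖zhat (k + 1) - z'‖ ^ 2 = ‖ζ - z'‖ ^ 2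
        + 2 * -(κ * γ * K) * (⟪ζ, r⟫ - ⟪z', r⟫) + (κ * γ * K) ^ 2 * ‖r‖ ^ 2 := by
      rw [← inner_sub_left, ← neg_sq (κ * γ * K), ← norm_add_smul_sq, hzhat k hk, hz k hk]
      congr 2
      module
    have hprimal : ‖xhat (k + 1) - xstar‖ ^ 2 = ‖w - xstar‖ ^ 2
        + 2 * (2 - α) * (⟪p - w, p - xstar⟫ - ‖p - w‖ ^ 2) + (2 - α) ^ 2 * ‖p - w‖ ^ 2 := by
      rw [← real_inner_self_eq_norm_sq (p - w), ← inner_sub_right, real_inner_comm,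
        real_inner_self_eq_norm_sq, show p - xstar - (p - w) = w - xstar by abel,
        ← norm_add_smul_sq, hhat k hk]
      congr 2
      module
    have hθ1 : K * (K + 1) * (1 - 2 / (K + 1)) = (K - 1) * K := by field_simp; ring
    have hθ2 : K * (K + 1) * (2 / (K + 1)) = 2 * K := by field_simp
    have hquad : K * (K + 1) * (L / 2 * (2 / (K + 1)) ^ 2 * ‖p - w‖ ^ 2)
        ≤ α * η * ‖p - w‖ ^ 2 := by
      rw [show K * (K + 1) * (L / 2 * (2 / (K + 1)) ^ 2 * ‖p - w‖ ^ 2)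
        = 2 * L * ‖p - w‖ ^ 2 * (K / (K + 1)) by field_simp, hLα]
      exact mul_le_of_le_one_right (by positivity) ((div_le_one (by positivity)).2 (by linarith))
    have hx : η / (2 - α) * ‖xhat (k + 1) - xstar‖ ^ 2 = η / (2 - α) * ‖w - xstar‖ ^ 2
        + 2 * η * ⟪p - w, p - xstar⟫ - α * η * ‖p - w‖ ^ 2 := by
      rw [hprimal]; field_simp; ring
    have hd : ‖zhat (k + 1) - z'‖ ^ 2 / (γ * κ) = ‖ζ - z'‖ ^ 2 / (γ * κ)
        - 2 * K * (⟪ζ, r⟫ - ⟪z', r⟫) + κ * γ * K ^ 2 * ‖r‖ ^ 2 := by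
      rw [hdual]; field_simp; ring
    have hvi2 := mul_nonneg (by positivity : 0 ≤ 2 * K) hvi
    have hηK : 2 * K * (η / K * ⟪p - w, p - xstar⟫) = 2 * η * ⟪p - w, p - xstar⟫ := by
      field_simp
    have hgap := mul_le_mul_of_nonneg_left hdesc (by positivity : 0 ≤ K * (K + 1))
    simp only [Φ]
    rw [hres, hx, hd]
    linear_combination hvi2 + hgap + hquad - hηK
      + (f (xag k) + g (xag k) - f xstar - g xstar - ⟪z', T (xag k) - b⟫) * hθ1
      + (f xstar + ⟪f' (xmd k), p - xstar⟫ + g p - f xstar - g xstar - ⟪z', r⟫) * hθ2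
  have htel : ∀ z' : EuclideanSpace ℝ (Fin l), ∀ k : ℕ, 1 ≤ k →
      (k : ℝ) * (k + 1) * Φ z' (xag (k + 1)) + η / (2 - α) * ‖xhat (k + 1) - xstar‖ ^ 2
          + ‖zhat (k + 1) - z'‖ ^ 2 / (γ * κ)
        ≤ η / (2 - α) * ‖x 1 - xstar‖ ^ 2 + ‖z'‖ ^ 2 / (γ * κ) := by
    intro z' k hk
    induction k, hk using Nat.le_induction with
    | base =>
      have h := hstep z' 1 le_rfl
      rw [Nat.cast_one] at h ⊢
      rwa [sub_self, zero_mul, zero_mul, zero_add, ← hinit1, hinitzhat, zero_sub,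
        norm_neg] at h
    | succ k hk ih =>
      have h := hstep z' (k + 1) (by omega)
      push_cast at h ⊢
      rw [add_sub_cancel_right] at h
      exact h.trans ih
  intro k hk
  have hk0 : (0 : ℝ) < k := by exact_mod_cast hk
  refine abs_le_and_norm_le_of_forall_sub_inner_le (by positivity) (by positivity)
    (hKKT _ (hagX (k + 1) (by omega))) fun z' => ?_
  rw [one_div_mul_eq_div, le_div_iff₀ (by positivity), mul_comm]
  have h1 : 0 ≤ η / (2 - α) * ‖xhat (k + 1) - xstar‖ ^ 2 := by positivity
  have h2 : 0 ≤ ‖zhat (k + 1) - z'‖ ^ 2 / (γ * κ) := by positivity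
  have h3 := htel z' k hk
  simp only [Φ] at h3
  linarith
end

section
/- (One-iteration gap inequality of GLADMM.) Let X ⊆ ℝⁿ and Y ⊆ ℝᵐ be closed convex, f : ℝⁿ → ℝ convex differentiable with f(x') ≤ f(x) + ⟨∇f(x), x' − x⟩ + (L/2)‖x' − x‖² for all x, x' (L ≥ 0), g : ℝᵐ → ℝ convex, A ∈ ℝ^{l×n}, B ∈ ℝ^{l×m}, b ∈ ℝˡ, and let (x*, y*) ∈ X × Y satisfy B y* − A x* = b. Define the gap function Q(x̃, ỹ, z̃; x, y, z) = [f(x) + g(y) − ⟨z̃, B y − A x − b⟩] − [f(x̃) + g(ỹ) − ⟨z, B ỹ − A x̃ − b⟩]. Fix θ ∈ (0, 1], λ, τ, γ, η > 0, ξ > 0, and α, β ∈ (0, 1), κ > 1 with Lθ/η ≤ α, 1/ξ ≤ β, and (τ + (1 − ξ)λ)/γ ≥ κ. Given x_ag, x̂ ∈ ℝⁿ, y_ag, ŷ ∈ ℝᵐ, z_ag, ẑ ∈ ℝˡ, define: x_md = (1 − θ) x_ag + θ x̂; x⁺ a minimizer over X of x ↦ ⟨∇f(x_md), x⟩ + (λ/2)‖B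 ŷ − A x − b‖² + ⟨ẑ, A x⟩ + (η/2)‖x − x̂‖²; x̂⁺ = (2 − α) x⁺ + (α − 1) x̂; x_ag⁺ = (1 − θ) x_ag + θ x⁺; y⁺ a minimizer over Y of y ↦ g(y) − ⟨ẑ, B y⟩ + (τ/2)‖B y − A x⁺ − b‖²; ŷ⁺ = (2 − β) y⁺ + (β − 1) ŷ; y_ag⁺ = (1 − θ) y_ag + θ y⁺; z⁺ = ẑ − γ (B y⁺ − A x⁺ − b); ẑ⁺ = (1 − κ) ẑ + κ z⁺; z_ag⁺ = (1 − θ) z_ag + θ z⁺. Then for every z ∈ ℝˡ: Q(x*, y*, z; x_ag⁺, y_ag⁺, z_ag⁺) − (1 − θ)·Q(x*, y*, z; x_ag, y_ag, z_ag) ≤ θ·[ (η/(2(2 − α)))·(‖x̂ − x*‖² − ‖x̂⁺ − x*‖²) + (λ/(2(2 − β)))·(‖B ŷ − B y*‖² − ‖B ŷ⁺ − B y*‖²) + (1/(2γκ))·(‖ẑ − z‖² − ‖ẑ⁺ − z‖²) + ((τ − λ)/2)·‖A(x⁺ − x*)‖² − ((τ − λ)/2)·‖B y⁺ − B y*‖²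 ]. -/
open scoped RealInnerProductSpace

/-- The gap function `Q(x̃, ỹ, z̃; x, y, z)` of the two-block linearly constrained
problem `min f(x) + g(y)  s.t.  B y − A x = b`. -/
noncomputable def gapQ {n m l : ℕ}
    (f : EuclideanSpace ℝ (Fin n) → ℝ) (g : EuclideanSpace ℝ (Fin m) → ℝ)
    (A : Matrix (Fin l) (Fin n) ℝ) (B : Matrix (Fin l) (Fin m) ℝ)
    (b : EuclideanSpace ℝ (Fin l))
    (xt : EuclideanSpace ℝ (Fin n)) (yt : EuclideanSpace ℝ (Fin m))
    (zt : EuclideanSpace ℝ (Fin l))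
    (x : EuclideanSpace ℝ (Fin n)) (y : EuclideanSpace ℝ (Fin m))
    (z : EuclideanSpace ℝ (Fin l)) : ℝ :=
  (f x + g y - ⟪zt, Matrix.toEuclideanLin B y - Matrix.toEuclideanLin A x - b⟫)
    - (f xt + g yt - ⟪z, Matrix.toEuclideanLin B yt - Matrix.toEuclideanLin A xt - b⟫)

/-- The gradient inequality for convex functions. -/
theorem ConvexOn.add_inner_gradient_le {E : Type*} [NormedAddCommGroup E]
    [InnerProductSpace ℝ E] [CompleteSpace E] {f : E → ℝ} {v x : E}
    (hf : ConvexOn ℝ Set.univ f) (hv : HasGradientAt f v x) (y : E) :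
    f x + ⟪v, y - x⟫ ≤ f y := by
  have hconv : ConvexOn ℝ Set.univ (f ∘ AffineMap.lineMap (k := ℝ) x y) := by
    simpa using hf.comp_affineMap (AffineMap.lineMap (k := ℝ) x y)
  have hderiv : HasDerivAt (f ∘ AffineMap.lineMap (k := ℝ) x y) ⟪v, y - x⟫ 0 := by
    have hx : HasFDerivAt f (InnerProductSpace.toDual ℝ E v)
        (AffineMap.lineMap (k := ℝ) x y 0) := by
      simpa using hv.hasFDerivAt
    simpa using hx.comp_hasDerivAt (0 : ℝ) AffineMap.hasDerivAt_lineMap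
  have h := hconv.le_slope_of_hasDerivAt (Set.mem_univ 0) (Set.mem_univ 1) one_pos hderiv
  simp [slope_def_field] at h
  linarith

/-- A quadratic without constant term that is nonnegative on `(0, 1]` has a nonnegative
linear coefficient. -/
theorem nonneg_of_forall_nonneg_quadratic {p q : ℝ}
    (h : ∀ t ∈ Set.Ioc (0 : ℝ) 1, 0 ≤ t * p + t ^ 2 * q) : 0 ≤ p := by
  by_contra! hp
  have hd : 0 < |q| - p := by linarith [abs_nonneg q]
  have hd' : (|q| - p) * (-p / (2 * (|q| - p))) = -p / 2 := by
    field_simp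
  have ht : 0 < -p / (2 * (|q| - p)) := div_pos (by linarith) (by linarith)
  have ht1 : -p / (2 * (|q| - p)) ≤ 1 := by
    rw [div_le_one (by linarith)]
    linarith [abs_nonneg q]
  have hmain := h _ ⟨ht, ht1⟩
  generalize -p / (2 * (|q| - p)) = t at *
  have hpq : 0 ≤ p + t * q := by
    refine nonneg_of_mul_nonneg_right (a := t) ?_ ht
    linarith
  nlinarith [le_abs_self q]

section VariationalInequality

variable {E F : Type*} [NormedAddCommGroup E] [InnerProductSpace ℝ E]
  [NormedAddCommGroup F] [InnerProductSpace ℝ F]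

/-- First-order optimality for a linearized, proximally regularized block subproblem. -/
theorem Convex.variational_inequality_of_isMin_prox {X : Set E} (hX : Convex ℝ X)
    (T : E →ₗ[ℝ] F) (v xhat xplus x : E) (c s : F) (lam η : ℝ)
    (hxplus : xplus ∈ X) (hx : x ∈ X)
    (hmin : ∀ u ∈ X,
      ⟪v, xplus⟫ + lam / 2 * ‖c - T xplus‖ ^ 2 + ⟪s, T xplus⟫ + η / 2 * ‖xplus - xhat‖ ^ 2
        ≤ ⟪v, u⟫ + lam / 2 * ‖c - T u‖ ^ 2 + ⟪s, T u⟫ + η / 2 * ‖u - xhat‖ ^ 2) :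
    0 ≤ ⟪v, x - xplus⟫ - lam * ⟪c - T xplus, T (x - xplus)⟫ + ⟪s, T (x - xplus)⟫
      + η * ⟪xplus - xhat, x - xplus⟫ := by
  refine nonneg_of_forall_nonneg_quadratic
    (q := lam / 2 * ‖T (x - xplus)‖ ^ 2 + η / 2 * ‖x - xplus‖ ^ 2) fun t ht => ?_
  have h := hmin _ (hX.add_smul_sub_mem hxplus hx ⟨ht.1.le, ht.2⟩)
  have e1 : c - T (xplus + t • (x - xplus)) = (c - T xplus) - t • T (x - xplus) := by
    rw [map_add, map_smul]; abel
  have e2 : xplus + t • (x - xplus) - xhat = (xplus - xhat) + t • (x - xplus) := by abel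
  have e3 : T (xplus + t • (x - xplus)) = T xplus + t • T (x - xplus) := by
    rw [map_add, map_smul]
  rw [e1, e2, e3, norm_sub_sq_real (c - T xplus), norm_add_sq_real] at h
  simp only [inner_add_right, real_inner_smul_right, norm_smul, mul_pow, Real.norm_eq_abs,
    sq_abs] at h
  linarith

/-- First-order optimality for a convex block subproblem with quadratic penalty. -/
theorem ConvexOn.variational_inequality_of_isMin_penalty {Y : Set E} {g : E → ℝ}
    (hg : ConvexOn ℝ Y g) (T : E →ₗ[ℝ] F) (yplus y : E) (c s : F) (τ : ℝ)
    (hyplus : yplus ∈ Y) (hy : y ∈ Y)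
    (hmin : ∀ u ∈ Y,
      g yplus - ⟪s, T yplus⟫ + τ / 2 * ‖T yplus - c‖ ^ 2
        ≤ g u - ⟪s, T u⟫ + τ / 2 * ‖T u - c‖ ^ 2) :
    0 ≤ g y - g yplus - ⟪s, T (y - yplus)⟫ + τ * ⟪T yplus - c, T (y - yplus)⟫ := by
  refine nonneg_of_forall_nonneg_quadratic (q := τ / 2 * ‖T (y - yplus)‖ ^ 2) fun t ht => ?_
  have h := hmin _ (hg.1.add_smul_sub_mem hyplus hy ⟨ht.1.le, ht.2⟩)
  have hgt := hg.2 hyplus hy (sub_nonneg.2 ht.2) ht.1.le (sub_add_cancel 1 t)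
  have e1 : (1 - t) • yplus + t • y = yplus + t • (y - yplus) := by module
  have e2 : T (yplus + t • (y - yplus)) - c = (T yplus - c) + t • T (y - yplus) := by
    rw [map_add, map_smul]; abel
  have e3 : T (yplus + t • (y - yplus)) = T yplus + t • T (y - yplus) := by
    rw [map_add, map_smul]
  rw [e1] at hgt
  rw [e2, e3, norm_add_sq_real] at h
  simp only [inner_add_right, real_inner_smul_right, norm_smul, mul_pow, Real.norm_eq_abs,
    sq_abs, smul_eq_mul] at h hgt
  linarith

/-- Telescoping form of an over-relaxed step `d`. -/
theorem norm_sq_sub_norm_add_smul_sq {c : ℝ} (hc : c ≠ 0) (μ : ℝ) (p d : E) :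
    μ / (2 * c) * (‖p‖ ^ 2 - ‖p + c • d‖ ^ 2) = -μ * ⟪p, d⟫ - μ * c / 2 * ‖d‖ ^ 2 := by
  rw [norm_add_sq_real, real_inner_smul_right, norm_smul, mul_pow, Real.norm_eq_abs, sq_abs]
  field_simp
  ring

/-- The coupling terms left over by the two block subproblems. -/
theorem coupling_le {lam τ γ ξ β κ : ℝ} (hlam : 0 ≤ lam) (hξ : 0 < ξ) (hξβ : 1 ≤ β * ξ)
    (hκ : κ * γ ≤ τ + (1 - ξ) * lam) (a v w : F) :
    lam * ⟪w - a, a⟫ - τ * ⟪v - a, v⟫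
      ≤ -lam * ⟪w, v - w⟫ - lam * (2 - β) / 2 * ‖v - w‖ ^ 2 - κ * γ / 2 * ‖v - a‖ ^ 2
        + (τ - lam) / 2 * ‖a‖ ^ 2 - (τ - lam) / 2 * ‖v‖ ^ 2 := by
  have hyoung : 0 ≤ ξ * ‖v - a‖ ^ 2 - 2 * ⟪v - a, v - w⟫ + β * ‖v - w‖ ^ 2 := by
    have hsq : 0 ≤ ‖ξ • (v - a) - (v - w)‖ ^ 2 := sq_nonneg _
    rw [norm_sub_sq_real, real_inner_smul_left, norm_smul, mul_pow, Real.norm_eq_abs,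
      sq_abs] at hsq
    refine nonneg_of_mul_nonneg_right (a := ξ) ?_ hξ
    nlinarith [mul_le_mul_of_nonneg_right hξβ (sq_nonneg ‖v - w‖)]
  have h1 := mul_nonneg hlam hyoung
  have h2 := mul_le_mul_of_nonneg_right hκ (sq_nonneg ‖v - a‖)
  simp only [norm_sub_sq_real, inner_sub_left, inner_sub_right, real_inner_self_eq_norm_sq,
    real_inner_comm v a, real_inner_comm v w, real_inner_comm w a] at h1 h2 ⊢
  linarith

end VariationalInequality

/-- One accelerated linearized step of a smooth convex function. -/
theorem accelerated_step_le {E : Type*} [NormedAddCommGroup E] [InnerProductSpace ℝ E]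
    [CompleteSpace E] {f : E → ℝ} {v : E} {L θ : ℝ} (hf : ConvexOn ℝ Set.univ f)
    (hθ : θ ∈ Set.Ioc (0 : ℝ) 1) (xag xhat xplus x : E)
    (hv : HasGradientAt f v ((1 - θ) • xag + θ • xhat))
    (hsmooth : ∀ u, f u ≤ f ((1 - θ) • xag + θ • xhat)
      + ⟪v, u - ((1 - θ) • xag + θ • xhat)⟫
      + L / 2 * ‖u - ((1 - θ) • xag + θ • xhat)‖ ^ 2) :
    f ((1 - θ) • xag + θ • xplus) ≤ (1 - θ) * f xag
      + θ * (f x + ⟪v, xplus - x⟫ + L * θ / 2 * ‖xplus - xhat‖ ^ 2) := by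
  set m := (1 - θ) • xag + θ • xhat with hm
  have h := hsmooth ((1 - θ) • xag + θ • xplus)
  have h1 := mul_le_mul_of_nonneg_left (hf.add_inner_gradient_le hv xag) (sub_nonneg.2 hθ.2)
  have h2 := mul_le_mul_of_nonneg_left (hf.add_inner_gradient_le hv x) hθ.1.le
  have hn : ‖(1 - θ) • xag + θ • xplus - m‖ ^ 2 = θ ^ 2 * ‖xplus - xhat‖ ^ 2 := by
    rw [hm, add_sub_add_left_eq_sub, ← smul_sub, norm_smul, mul_pow, Real.norm_eq_abs, sq_abs]
  rw [hn] at h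
  simp only [inner_sub_right, inner_add_right, real_inner_smul_right] at h h1 h2 ⊢
  linarith

theorem gladmm_one_iteration {n m l : ℕ}
    (X : Set (EuclideanSpace ℝ (Fin n))) (hXcl : IsClosed X) (hXcv : Convex ℝ X)
    (Y : Set (EuclideanSpace ℝ (Fin m))) (hYcl : IsClosed Y) (hYcv : Convex ℝ Y)
    (f : EuclideanSpace ℝ (Fin n) → ℝ) (g : EuclideanSpace ℝ (Fin m) → ℝ)
    (f' : EuclideanSpace ℝ (Fin n) → EuclideanSpace ℝ (Fin n))
    (L : ℝ) (hL : 0 ≤ L)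
    (hdiff : ∀ x, HasGradientAt f (f' x) x)
    (hfconv : ConvexOn ℝ Set.univ f)
    (hgconv : ConvexOn ℝ Set.univ g)
    (hsmooth : ∀ x x', f x' ≤ f x + ⟪f' x, x' - x⟫ + L / 2 * ‖x' - x‖ ^ 2)
    (A : Matrix (Fin l) (Fin n) ℝ) (B : Matrix (Fin l) (Fin m) ℝ)
    (b : EuclideanSpace ℝ (Fin l))
    (xstar : EuclideanSpace ℝ (Fin n)) (ystar : EuclideanSpace ℝ (Fin m))
    (hstarX : xstar ∈ X) (hstarY : ystar ∈ Y)
    (hstarfeas : Matrix.toEuclideanLin B ystar - Matrix.toEuclideanLin A xstar = b)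
    (θ lam τ γ η ξ α β κ : ℝ)
    (hθ : θ ∈ Set.Ioc (0 : ℝ) 1) (hlam : 0 < lam) (hτ : 0 < τ) (hγ : 0 < γ)
    (hη : 0 < η) (hξ : 0 < ξ)
    (hα : α ∈ Set.Ioo (0 : ℝ) 1) (hβ : β ∈ Set.Ioo (0 : ℝ) 1) (hκ : 1 < κ)
    (hαbound : L * θ / η ≤ α) (hβbound : 1 / ξ ≤ β)
    (hκbound : κ ≤ (τ + (1 - ξ) * lam) / γ)
    (xag xhat xmd xplus xhatp xagp : EuclideanSpace ℝ (Fin n))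
    (yag yhat yplus yhatp yagp : EuclideanSpace ℝ (Fin m))
    (zag zhat zplus zhatp zagp : EuclideanSpace ℝ (Fin l))
    (hmd : xmd = (1 - θ) • xag + θ • xhat)
    (hxplusX : xplus ∈ X)
    (hxplusmin : ∀ x ∈ X,
      ⟪f' xmd, xplus⟫
          + lam / 2 * ‖Matrix.toEuclideanLin B yhat - Matrix.toEuclideanLin A xplus - b‖ ^ 2
          + ⟪zhat, Matrix.toEuclideanLin A xplus⟫ + η / 2 * ‖xplus - xhat‖ ^ 2
        ≤ ⟪f' xmd, x⟫
          + lam / 2 * ‖Matrix.toEuclideanLin B yhat - Matrix.toEuclideanLin A x - b‖ ^ 2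
          + ⟪zhat, Matrix.toEuclideanLin A x⟫ + η / 2 * ‖x - xhat‖ ^ 2)
    (hxhatp : xhatp = (2 - α) • xplus + (α - 1) • xhat)
    (hxagp : xagp = (1 - θ) • xag + θ • xplus)
    (hyplusY : yplus ∈ Y)
    (hyplusmin : ∀ y ∈ Y,
      g yplus - ⟪zhat, Matrix.toEuclideanLin B yplus⟫
          + τ / 2 * ‖Matrix.toEuclideanLin B yplus - Matrix.toEuclideanLin A xplus - b‖ ^ 2
        ≤ g y - ⟪zhat, Matrix.toEuclideanLin B y⟫
          + τ / 2 * ‖Matrix.toEuclideanLin B y - Matrix.toEuclideanLin A xplus - b‖ ^ 2)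
    (hyhatp : yhatp = (2 - β) • yplus + (β - 1) • yhat)
    (hyagp : yagp = (1 - θ) • yag + θ • yplus)
    (hz : zplus = zhat
      - γ • (Matrix.toEuclideanLin B yplus - Matrix.toEuclideanLin A xplus - b))
    (hzhatp : zhatp = (1 - κ) • zhat + κ • zplus)
    (hzagp : zagp = (1 - θ) • zag + θ • zplus) :
    ∀ z : EuclideanSpace ℝ (Fin l),
      gapQ f g A B b xstar ystar z xagp yagp zagp
          - (1 - θ) * gapQ f g A B b xstar ystar z xag yag zag
        ≤ θ * (η / (2 * (2 - α)) * (‖xhat - xstar‖ ^ 2 - ‖xhatp - xstar‖ ^ 2)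
            + lam / (2 * (2 - β))
              * (‖Matrix.toEuclideanLin B yhat - Matrix.toEuclideanLin B ystar‖ ^ 2
                - ‖Matrix.toEuclideanLin B yhatp - Matrix.toEuclideanLin B ystar‖ ^ 2)
            + 1 / (2 * γ * κ) * (‖zhat - z‖ ^ 2 - ‖zhatp - z‖ ^ 2)
            + (τ - lam) / 2 * ‖Matrix.toEuclideanLin A (xplus - xstar)‖ ^ 2
            - (τ - lam) / 2
              * ‖Matrix.toEuclideanLin B yplus - Matrix.toEuclideanLin B ystar‖ ^ 2) := by
  intro z
  set TA := Matrix.toEuclideanLin A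
  set TB := Matrix.toEuclideanLin B
  have hx := hXcv.variational_inequality_of_isMin_prox TA (f' xmd) xhat xplus xstar (TB yhat - b)
    zhat lam η hxplusX hstarX fun u hu => by
      simpa only [sub_right_comm] using hxplusmin u hu
  have hy := (hgconv.subset (Set.subset_univ Y) hYcv).variational_inequality_of_isMin_penalty TB
    yplus ystar (TA xplus + b) zhat τ hyplusY hstarY fun u hu => by
      simpa only [sub_sub] using hyplusmin u hu
  have hf := accelerated_step_le (L := L) hfconv hθ xag xhat xplus xstar
    (hmd ▸ hdiff xmd) (hmd ▸ hsmooth xmd)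
  have hg := hgconv.2 (Set.mem_univ yag) (Set.mem_univ yplus) (sub_nonneg.2 hθ.2) hθ.1.le
    (sub_add_cancel 1 θ)
  have hcoup := coupling_le hlam.le hξ ((div_le_iff₀ hξ).1 hβbound) ((le_div_iff₀ hγ).1 hκbound)
    (TA (xplus - xstar)) (TB (yplus - ystar)) (TB (yhat - ystar))
  have hxtel := norm_sq_sub_norm_add_smul_sq (c := 2 - α) (by linarith [hα.2]) η
    (xhat - xstar) (xplus - xhat)
  have hytel := norm_sq_sub_norm_add_smul_sq (c := 2 - β) (by linarith [hβ.2]) lam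
    (TB (yhat - ystar)) (TB (yplus - ystar) - TB (yhat - ystar))
  have hztel := norm_sq_sub_norm_add_smul_sq (c := γ * κ) (by positivity) 1
    (zhat - z) (TA (xplus - xstar) - TB (yplus - ystar))
  have hLα : L * θ / 2 * ‖xplus - xhat‖ ^ 2 ≤ α * η / 2 * ‖xplus - xhat‖ ^ 2 := by
    have := (div_le_iff₀ hη).1 hαbound
    gcongr
  have ex : xhat - xstar + (2 - α) • (xplus - xhat) = xhatp - xstar := by
    rw [hxhatp]; module
  have ey : TB (yhat - ystar) + (2 - β) • (TB (yplus - ystar) - TB (yhat - ystar))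
      = TB yhatp - TB ystar := by
    rw [hyhatp]; simp only [map_sub, map_add, map_smul]; module
  have ez : zhat - z + (γ * κ) • (TA (xplus - xstar) - TB (yplus - ystar)) = zhatp - z := by
    rw [hzhatp, hz, ← hstarfeas]; simp only [map_sub]; module
  rw [ex] at hxtel
  rw [ey] at hytel
  rw [ez, ← mul_assoc] at hztel
  have hlin : TB yagp - TA xagp - b
      = (1 - θ) • (TB yag - TA xag - b) + θ • (TB (yplus - ystar) - TA (xplus - xstar)) := by
    rw [hyagp, hxagp, ← hstarfeas]; simp only [map_sub, map_add, map_smul]; module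
  have e1 : TB yhat - b - TA xplus = TB (yhat - ystar) - TA (xplus - xstar) := by
    rw [← hstarfeas]; simp only [map_sub]; abel
  have e2 : TB yplus - (TA xplus + b) = TB (yplus - ystar) - TA (xplus - xstar) := by
    rw [← hstarfeas]; simp only [map_sub]; abel
  have e3 : TA (xstar - xplus) = -TA (xplus - xstar) := by rw [← map_neg, neg_sub]
  have e4 : TB (ystar - yplus) = -TB (yplus - ystar) := by rw [← map_neg, neg_sub]
  rw [e1, e3] at hx
  rw [e2, e4] at hy
  have e5 : ⟪xplus - xhat, xstar - xplus⟫
      = -⟪xhat - xstar, xplus - xhat⟫ - ‖xplus - xhat‖ ^ 2 := by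
    rw [show xstar - xplus = -(xhat - xstar) - (xplus - xhat) by abel, inner_sub_right,
      inner_neg_right, real_inner_self_eq_norm_sq, real_inner_comm]
  have e6 : ⟪f' xmd, xstar - xplus⟫ = -⟪f' xmd, xplus - xstar⟫ := by
    rw [← inner_neg_right, neg_sub]
  rw [e5, e6] at hx
  rw [← hxagp, ← hmd] at hf
  rw [← hyagp, smul_eq_mul, smul_eq_mul] at hg
  have hfeas0 : TB ystar - TA xstar - b = 0 := by rw [hstarfeas, sub_self]
  have hsum : (f xstar + ⟪f' xmd, xplus - xstar⟫ + L * θ / 2 * ‖xplus - xhat‖ ^ 2) + g yplus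
      - ⟪z, TB (yplus - ystar) - TA (xplus - xstar)⟫ - f xstar - g ystar
      ≤ η / (2 * (2 - α)) * (‖xhat - xstar‖ ^ 2 - ‖xhatp - xstar‖ ^ 2)
        + lam / (2 * (2 - β)) * (‖TB yhat - TB ystar‖ ^ 2 - ‖TB yhatp - TB ystar‖ ^ 2)
        + 1 / (2 * γ * κ) * (‖zhat - z‖ ^ 2 - ‖zhatp - z‖ ^ 2)
        + (τ - lam) / 2 * ‖TA (xplus - xstar)‖ ^ 2
        - (τ - lam) / 2 * ‖TB yplus - TB ystar‖ ^ 2 := by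
    rw [norm_sub_rev (TA (xplus - xstar)), ← neg_sub (TB (yplus - ystar))] at hztel
    rw [← map_sub TB yhat, ← map_sub TB yplus, hxtel, hytel, hztel]
    simp only [inner_neg_right, inner_sub_left zhat, inner_sub_right zhat,
      inner_sub_right z] at hx hy hztel ⊢
    linarith
  have hmul := mul_le_mul_of_nonneg_left hsum hθ.1.le
  simp only [gapQ]
  change (f xagp + g yagp - ⟪z, TB yagp - TA xagp - b⟫)
      - (f xstar + g ystar - ⟪zagp, TB ystar - TA xstar - b⟫)
      - (1 - θ) * ((f xag + g yag - ⟪z, TB yag - TA xag - b⟫)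
        - (f xstar + g ystar - ⟪zag, TB ystar - TA xstar - b⟫)) ≤ _
  rw [hfeas0, hlin, inner_zero_right, inner_zero_right, inner_add_right, real_inner_smul_right,
    real_inner_smul_right]
  refine le_trans ?_ hmul
  linarith
end
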